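/- arXiv:2003.01964 — 9 statements merged into one kernel-verified Lean document; each statement's English description precedes it below -/
import Mathlib

section
/- For every finite type X, every probability distribution ω on X, every K ∈ ℕ, and every multiset φ over X of size K, one has ∑_{x ∈ X} ((φ(x)+1)/(K+1)) · mn_{K+1}(ω)(φ + {x}) = mn_K(ω)(φ); that is, the multinomial channels commute with the draw-and-delete channels, so they form a cone over the draw-and-delete chain. -/
open Finset

/-- The multinomial distribution `mn_K(ω)` on multisets of size `K` over a finite type `X`:
`mn_K(ω)(φ) = (K! / ∏ₓ φ(x)!) · ∏ₓ ω(x)^{φ(x)}`. -/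
noncomputable def multinomial {X : Type*} [Fintype X] [DecidableEq X]
    (K : ℕ) (ω : X → ℝ) (φ : Multiset X) : ℝ :=
  ((K.factorial : ℝ) / ∏ x : X, ((φ.count x).factorial : ℝ)) * ∏ x : X, ω x ^ φ.count x

theorem prod_factorial_count_add_singleton {X : Type*} [Fintype X] [DecidableEq X]
    (φ : Multiset X) (x : X) :
    ∏ y : X, (((φ + {x}).count y).factorial : ℝ)
      = ((φ.count x : ℝ) + 1) * ∏ y : X, ((φ.count y).factorial : ℝ) := by
  rw [← prod_erase_mul univ _ (mem_univ x),
    ← prod_erase_mul univ (fun y => ((φ.count y).factorial : ℝ)) (mem_univ x),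
    prod_congr rfl (g := fun y => ((φ.count y).factorial : ℝ))
      fun y hy => by simp [ne_of_mem_erase hy]]
  simp [Nat.factorial_succ]
  ring

theorem prod_pow_count_add_singleton {X M : Type*} [Fintype X] [DecidableEq X] [CommMonoid M]
    (ω : X → M) (φ : Multiset X) (x : X) :
    ∏ y : X, ω y ^ (φ + {x}).count y = ω x * ∏ y : X, ω y ^ φ.count y := by
  simp only [Multiset.count_add, Multiset.count_singleton, pow_add, prod_mul_distrib, pow_ite,
    pow_one, pow_zero, prod_ite_eq', mem_univ, if_true, mul_comm]

theorem drawDelete_weight_mul_multinomial {X : Type*} [Fintype X] [DecidableEq X]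
    (ω : X → ℝ) (K : ℕ) (φ : Multiset X) (x : X) :
    (((φ.count x : ℝ) + 1) / ((K : ℝ) + 1)) * multinomial (K + 1) ω (φ + {x})
      = ω x * multinomial K ω φ := by
  have hprod : ∏ y : X, ((φ.count y).factorial : ℝ) ≠ 0 :=
    prod_ne_zero_iff.mpr fun y _ => by positivity
  have hK : (K : ℝ) + 1 ≠ 0 := by positivity
  have hx : (φ.count x : ℝ) + 1 ≠ 0 := by positivity
  rw [multinomial, multinomial, prod_factorial_count_add_singleton,
    prod_pow_count_add_singleton, Nat.factorial_succ]
  push_cast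
  field_simp

/-- The multinomial channels form a cone over the draw-and-delete chain:
drawing and deleting a random element from a multinomially distributed multiset of size
`K+1` yields the multinomial distribution of size `K`. -/
theorem multinomial_cone_drawDelete {X : Type*} [Fintype X] [DecidableEq X]
    (ω : X → ℝ) (hω : ∀ x, 0 ≤ ω x) (hsum : ∑ x : X, ω x = 1)
    (K : ℕ) (φ : Multiset X) (hφ : Multiset.card φ = K) :
    ∑ x : X, (((φ.count x : ℝ) + 1) / ((K : ℝ) + 1)) * multinomial (K + 1) ω (φ + {x})
      = multinomial K ω φ := by
  simp only [drawDelete_weight_mul_multinomial, ← sum_mul, hsum, one_mul]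
end

section
/- For all K, N ∈ ℕ, the N-fold Kleisli composite of draw-and-delete channels D_K ∘ D_{K+1} ∘ ⋯ ∘ D_{K+N−1} : {0,…,K+N} → PMF({0,…,K}) is the hypergeometric distribution: for every ℓ ≤ K+N and k ≤ K, its probability of outcome k starting from ℓ equals C(ℓ,k) · C(K+N−ℓ, K−k) / C(K+N, K), where C(n,m) is the binomial coefficient (interpreted as 0 when m > n). -/
open Finset

/-- The draw-and-delete channel `D_K : {0,…,K+1} → PMF({0,…,K})`,
`D_K(ℓ) = (ℓ/(K+1))·δ_{ℓ−1} + ((K+1−ℓ)/(K+1))·δ_ℓ`, given as a mass function. -/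
noncomputable def drawDel (K ℓ k : ℕ) : ℝ :=
  (if k + 1 = ℓ then (ℓ : ℝ) / ((K : ℝ) + 1) else 0)
    + (if k = ℓ then ((K : ℝ) + 1 - (ℓ : ℝ)) / ((K : ℝ) + 1) else 0)

/-- The `N`-fold Kleisli composite `D_K ∘ D_{K+1} ∘ ⋯ ∘ D_{K+N−1} : {0,…,K+N} → PMF({0,…,K})`. -/
noncomputable def drawDelIter (K : ℕ) : ℕ → ℕ → ℕ → ℝ
  | 0, ℓ, k => if k = ℓ then 1 else 0
  | N + 1, ℓ, k => ∑ j ∈ Finset.range (K + N + 1), drawDel (K + N) ℓ j * drawDelIter K N j k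

theorem natCast_mul_choose_pred (n k : ℕ) :
    (n : ℝ) * ((n - 1).choose k : ℝ) = ((n : ℝ) - k) * (n.choose k : ℝ) := by
  cases n with
  | zero => cases k <;> simp
  | succ n =>
    rcases le_or_gt k (n + 1) with h | h
    · have := congrArg (Nat.cast (R := ℝ)) (Nat.choose_mul_succ_eq n k)
      push_cast [Nat.cast_sub h] at this
      simp only [Nat.add_sub_cancel]
      push_cast
      linarith
    · simp [Nat.choose_eq_zero_of_lt h, Nat.choose_eq_zero_of_lt (show n < k by omega)]

theorem sum_drawDel_mul (M ℓ : ℕ) (hℓ : ℓ ≤ M + 1) (f : ℕ → ℝ) :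
    ∑ j ∈ Finset.range (M + 1), drawDel M ℓ j * f j
      = (ℓ * f (ℓ - 1) + ((M : ℝ) + 1 - ℓ) * f ℓ) / ((M : ℝ) + 1) := by
  have hdel : ∑ j ∈ Finset.range (M + 1), (if j = ℓ then ((M : ℝ) + 1 - ℓ) / (M + 1) else 0) * f j
      = ((M : ℝ) + 1 - ℓ) * f ℓ / (M + 1) := by
    simp only [ite_mul, zero_mul, Finset.sum_ite_eq', Finset.mem_range]
    split_ifs with h
    · ring
    · obtain rfl : ℓ = M + 1 := by omega
      simp
  have hdraw : ∑ j ∈ Finset.range (M + 1), (if j + 1 = ℓ then (ℓ : ℝ) / (M + 1) else 0) * f j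
      = ℓ * f (ℓ - 1) / (M + 1) := by
    cases ℓ with
    | zero => simp
    | succ m =>
      simp only [Nat.add_right_cancel_iff, ite_mul, zero_mul, Finset.sum_ite_eq',
        Finset.mem_range, Nat.add_sub_cancel]
      rw [if_pos (by omega)]
      ring
  simp only [drawDel, add_mul, Finset.sum_add_distrib]
  rw [hdel, hdraw]
  ring

/-- The `N`-fold Kleisli composite of draw-and-delete channels is the hypergeometric
distribution: its probability of outcome `k ≤ K` starting from `ℓ ≤ K+N` equals
`C(ℓ,k)·C(K+N−ℓ,K−k)/C(K+N,K)`. -/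
theorem drawDelIter_eq_hypergeometric (K N ℓ k : ℕ) (hℓ : ℓ ≤ K + N) (hk : k ≤ K) :
    drawDelIter K N ℓ k
      = ((ℓ.choose k : ℝ) * ((K + N - ℓ).choose (K - k) : ℝ)) / ((K + N).choose K : ℝ) := by
  induction N generalizing ℓ with
  | zero =>
    simp only [drawDelIter, Nat.add_zero, Nat.choose_self, Nat.cast_one, div_one] at hℓ ⊢
    rcases lt_trichotomy k ℓ with h | rfl | h
    · simp [h.ne, Nat.choose_eq_zero_of_lt (show K - ℓ < K - k by omega)]
    · simp
    · simp [h.ne', Nat.choose_eq_zero_of_lt h]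
  | succ N ih =>
    obtain ⟨b, hb⟩ := Nat.exists_eq_add_of_le hℓ
    have hbR : (K : ℝ) + N + 1 = ℓ + b := by exact_mod_cast hb
    have hdraw : (ℓ : ℝ) * drawDelIter K N (ℓ - 1) k
        = ((ℓ : ℝ) - k) * ℓ.choose k * b.choose (K - k) / ((K + N).choose K : ℝ) := by
      rcases Nat.eq_zero_or_pos ℓ with rfl | h
      · cases k <;> simp
      · rw [ih (ℓ - 1) (by omega), show K + N - (ℓ - 1) = b by omega,
          ← natCast_mul_choose_pred]
        ring
    have hdel : (b : ℝ) * drawDelIter K N ℓ k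
        = ((b : ℝ) - (K - k : ℕ)) * b.choose (K - k) * ℓ.choose k / ((K + N).choose K : ℝ) := by
      rw [← natCast_mul_choose_pred]
      rcases Nat.eq_zero_or_pos b with rfl | h
      · simp
      · rw [ih ℓ (by omega), show K + N - ℓ = b - 1 by omega]
        ring
    have htotal := natCast_mul_choose_pred (K + N + 1) K
    rw [Nat.add_sub_cancel] at htotal
    push_cast at htotal
    rw [drawDelIter, sum_drawDel_mul (K + N) ℓ hℓ, hdraw]
    push_cast
    rw [show (K : ℝ) + N + 1 - ℓ = b by linarith, hdel, Nat.cast_sub hk,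
      show K + (N + 1) - ℓ = b by omega, ← Nat.add_assoc]
    have h₁ : ((K + N).choose K : ℝ) ≠ 0 := by
      exact_mod_cast (Nat.choose_pos (Nat.le_add_right K N)).ne'
    have h₂ : ((K + N + 1).choose K : ℝ) ≠ 0 := by
      exact_mod_cast (Nat.choose_pos (show K ≤ K + N + 1 by omega)).ne'
    have h₃ : (K : ℝ) + N + 1 ≠ 0 := by positivity
    rw [← add_div, div_div, div_eq_div_iff (mul_ne_zero h₁ h₃) h₂]
    linear_combination (-(ℓ.choose k : ℝ) * b.choose (K - k)) * htotal
      - (ℓ.choose k : ℝ) * b.choose (K - k) * (K + N + 1).choose K * hbR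
end

section
/- Fix K ∈ ℕ and k ≤ K, let p ∈ [0,1], and let (ℓ_N)_{N ∈ ℕ} be a sequence with ℓ_N ≤ K+N for all N and ℓ_N/(K+N) → p as N → ∞. Then the hypergeometric probability C(ℓ_N, k) · C(K+N−ℓ_N, K−k) / C(K+N, K) converges to the binomial probability C(K,k) · p^k · (1−p)^{K−k} as N → ∞. -/
open Filter

open scoped Nat in
/-- If `a / M → x` along a filter on which `M → ∞`, then `C(a, j) / M ^ j → x ^ j / j!`. -/
theorem tendsto_choose_div_pow {α : Type*} {f : Filter α} {a : α → ℕ} {M : α → ℝ} {x : ℝ}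
    (hM : Tendsto M f atTop) (ha : Tendsto (fun i => (a i : ℝ) / M i) f (nhds x)) (j : ℕ) :
    Tendsto (fun i => ((a i).choose j : ℝ) / M i ^ j) f (nhds (x ^ j / (j ! : ℝ))) := by
  have hdesc : Tendsto (fun i => ((a i).descFactorial j : ℝ) / M i ^ j) f (nhds (x ^ j)) := by
    induction j with
    | zero => simpa using tendsto_const_nhds
    | succ j ih =>
      have hshift : Tendsto (fun i => (a i : ℝ) / M i - j / M i) f (nhds x) := by
        simpa using ha.sub (tendsto_const_nhds.div_atTop hM)
      rw [pow_succ']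
      refine (hshift.mul ih).congr fun i => ?_
      rw [← sub_div, div_mul_div_comm, ← pow_succ', Nat.descFactorial_succ, Nat.cast_mul]
      rcases le_or_gt j (a i) with h | h
      · rw [Nat.cast_sub h]
      · simp [Nat.descFactorial_of_lt h]
  refine (hdesc.div_const _).congr fun i => ?_
  have hj : (j ! : ℝ) ≠ 0 := mod_cast j.factorial_ne_zero
  rw [Nat.descFactorial_eq_factorial_mul_choose, Nat.cast_mul]
  field_simp

/-- Convergence of the hypergeometric distribution to the binomial distribution: if
`ℓ_N ≤ K+N` and `ℓ_N/(K+N) → p`, then the hypergeometric probability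
`C(ℓ_N,k)·C(K+N−ℓ_N,K−k)/C(K+N,K)` converges to the binomial probability
`C(K,k)·p^k·(1−p)^{K−k}`. -/
theorem hypergeometric_tendsto_binomial (K k : ℕ) (hk : k ≤ K)
    (p : ℝ) (hp : p ∈ Set.Icc (0 : ℝ) 1)
    (ℓ : ℕ → ℕ) (hℓ : ∀ N, ℓ N ≤ K + N)
    (hconv : Tendsto (fun N : ℕ => (ℓ N : ℝ) / ((K : ℝ) + (N : ℝ))) atTop (nhds p)) :
    Tendsto
      (fun N : ℕ =>
        (((ℓ N).choose k : ℝ) * (((K + N - ℓ N).choose (K - k) : ℕ) : ℝ))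
          / (((K + N).choose K : ℕ) : ℝ))
      atTop (nhds ((K.choose k : ℝ) * p ^ k * (1 - p) ^ (K - k))) := by
  have hM : Tendsto (fun N : ℕ => (K : ℝ) + N) atTop atTop :=
    tendsto_atTop_add_const_left _ _ tendsto_natCast_atTop_atTop
  have hM0 : ∀ᶠ N : ℕ in atTop, (K : ℝ) + N ≠ 0 := hM.eventually_ne_atTop 0
  have hcompl : Tendsto (fun N => ((K + N - ℓ N : ℕ) : ℝ) / ((K : ℝ) + N)) atTop
      (nhds (1 - p)) := by
    refine (hconv.const_sub 1).congr' ?_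
    filter_upwards [hM0] with N hN
    rw [Nat.cast_sub (hℓ N), Nat.cast_add, sub_div, div_self hN]
  have htotal : Tendsto (fun N => ((K + N : ℕ) : ℝ) / ((K : ℝ) + N)) atTop (nhds 1) := by
    refine tendsto_const_nhds.congr' ?_
    filter_upwards [hM0] with N hN
    rw [Nat.cast_add, div_self hN]
  have hK : (K.factorial : ℝ) ≠ 0 := mod_cast K.factorial_ne_zero
  have hlim := ((tendsto_choose_div_pow hM hconv k).mul
    (tendsto_choose_div_pow hM hcompl (K - k))).div (tendsto_choose_div_pow hM htotal K)
    (by simp [hK])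
  have hvalue : p ^ k / (k.factorial : ℝ) * ((1 - p) ^ (K - k) / ((K - k).factorial : ℝ))
      / (1 ^ K / (K.factorial : ℝ)) = (K.choose k : ℝ) * p ^ k * (1 - p) ^ (K - k) := by
    rw [Nat.cast_choose ℝ hk, one_pow]
    field_simp
  rw [hvalue] at hlim
  refine hlim.congr' ?_
  filter_upwards [hM0] with N hN
  simp only [Pi.div_apply]
  rw [div_mul_div_comm, ← pow_add, Nat.add_sub_cancel' hk,
    div_div_div_cancel_right₀ (pow_ne_zero K hN)]
end

section
/- Let h : X → PMF(Bool × X) be an exchangeable coalgebra. Then for every K ∈ ℕ, every x ∈ X, every tuple b ∈ Bool^K, and every permutation σ of {1,…,K}, the iterated output distribution satisfies h♯_K(x)(b ∘ σ) = h♯_K(x)(b); that is, the distribution of the first K outputs is invariant under all permutations of the output positions. -/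
open scoped ENNReal

/-- A coalgebra `h : X → PMF (Bool × X)` is exchangeable if the distribution of
(first output, second output, final state) under two successive steps equals the
distribution of (second output, first output, final state). -/
def Exchangeable {X : Type*} (h : X → PMF (Bool × X)) : Prop :=
  ∀ x : X,
    ((h x).bind fun p => (h p.2).map fun q => (p.1, q.1, q.2))
      = (h x).bind fun p => (h p.2).map fun q => (q.1, p.1, q.2)

/-- `h♯^K(x)`: the distribution of the `K`-tuple of outputs together with the final
state, obtained by iterating the coalgebra `h` for `K` steps from `x`. -/
noncomputable def iterSharp {X : Type*} (h : X → PMF (Bool × X)) :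
    (K : ℕ) → X → PMF ((Fin K → Bool) × X)
  | 0, x => PMF.pure (Fin.elim0, x)
  | K + 1, x =>
      (iterSharp h K x).bind fun p =>
        (h p.2).map fun q => (Fin.snoc p.1 q.1, q.2)

/-- `h♯_K(x)`: the distribution of the first `K` outputs of the coalgebra `h` from `x`. -/
noncomputable def outputs {X : Type*} (h : X → PMF (Bool × X)) (K : ℕ) (x : X) :
    PMF (Fin K → Bool) :=
  (iterSharp h K x).map Prod.fst

/-- `h_K(x)(k)`: the probability that exactly `k` of the first `K` outputs equal `true`. -/
noncomputable def countDist {X : Type*} (h : X → PMF (Bool × X)) (K : ℕ) (x : X) (k : ℕ) :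
    ℝ≥0∞ :=
  ∑ b ∈ Finset.univ.filter
      (fun b : Fin K → Bool => (Finset.univ.filter fun i => b i = true).card = k),
    outputs h K x b

/-- The expectation of `f` under `μ`. -/
noncomputable def PMF.expect {α : Type*} (μ : PMF α) (f : α → ℝ≥0∞) : ℝ≥0∞ :=
  ∑' a, μ a * f a

theorem PMF.expect_pure {α : Type*} (a : α) (f : α → ℝ≥0∞) :
    (PMF.pure a).expect f = f a := by
  classical
  simp [PMF.expect, PMF.pure_apply]

theorem PMF.expect_bind {α β : Type*} (μ : PMF α) (k : α → PMF β) (f : β → ℝ≥0∞) :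
    (μ.bind k).expect f = μ.expect fun a => (k a).expect f := by
  simp only [PMF.expect, PMF.bind_apply, ← ENNReal.tsum_mul_right, ← ENNReal.tsum_mul_left]
  rw [ENNReal.tsum_comm]
  simp only [mul_assoc]

theorem PMF.expect_map {α β : Type*} (μ : PMF α) (k : α → β) (f : β → ℝ≥0∞) :
    (μ.map k).expect f = μ.expect fun a => f (k a) := by
  rw [← PMF.bind_pure_comp, PMF.expect_bind]
  simp only [Function.comp_apply, PMF.expect_pure]

theorem PMF.expect_zero {α : Type*} (μ : PMF α) : (μ.expect fun _ => 0) = 0 := by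
  simp [PMF.expect]

theorem PMF.expect_indicator {α : Type*} [DecidableEq α] (μ : PMF α) (a : α) :
    (μ.expect fun a' => if a' = a then 1 else 0) = μ a := by
  simp [PMF.expect]

/-- The expectation of `g` at the final state, restricted to the event that the successive
outputs of `h` from a given state form the list `l`. -/
noncomputable def listWeight {X : Type*} (h : X → PMF (Bool × X)) (g : X → ℝ≥0∞) :
    List Bool → X → ℝ≥0∞
  | [], x => g x
  | b :: l, x => (h x).expect fun q => if q.1 = b then listWeight h g l q.2 else 0

theorem listWeight_append {X : Type*} (h : X → PMF (Bool × X)) (g : X → ℝ≥0∞)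
    (l m : List Bool) (x : X) :
    listWeight h g (l ++ m) x = listWeight h (listWeight h g m) l x := by
  induction l generalizing x with
  | nil => rfl
  | cons b l ih => simp only [List.cons_append, listWeight, ih]

theorem Exchangeable.listWeight_perm {X : Type*} {h : X → PMF (Bool × X)}
    (hex : Exchangeable h) (g : X → ℝ≥0∞) {l m : List Bool} (hlm : l.Perm m) (x : X) :
    listWeight h g l x = listWeight h g m x := by
  induction hlm generalizing x with
  | nil => rfl
  | cons b _ ih => simp only [listWeight, ih]
  | trans _ _ ih₁ ih₂ => rw [ih₁, ih₂]
  | swap a b l =>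
    have key := congrArg (fun μ => PMF.expect μ fun t =>
      if t.1 = b then if t.2.1 = a then listWeight h g l t.2.2 else 0 else 0) (hex x)
    simp only [PMF.expect_bind, PMF.expect_map] at key
    simp only [listWeight]
    convert key using 3 with p p
    · split_ifs with hp
      · rfl
      · exact (PMF.expect_zero _).symm
    · split_ifs with hp
      · rfl
      · simp [PMF.expect_zero]

theorem iterSharp_expect {X : Type*} (h : X → PMF (Bool × X)) (g : X → ℝ≥0∞)
    (K : ℕ) (x : X) (b : Fin K → Bool) :
    ((iterSharp h K x).expect fun p => if p.1 = b then g p.2 else 0)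
      = listWeight h g (List.ofFn b) x := by
  induction K generalizing g with
  | zero =>
    rw [iterSharp, PMF.expect_pure, if_pos (Subsingleton.elim _ _), List.ofFn_zero, listWeight]
  | succ K ih =>
    rw [List.ofFn_succ', List.concat_eq_append, listWeight_append, ← ih]
    simp only [iterSharp, PMF.expect_bind, PMF.expect_map, listWeight]
    congr 1
    funext p
    have hsnoc (c : Bool) : (Fin.snoc p.1 c : Fin (K + 1) → Bool) = b ↔
        p.1 = (fun i => b i.castSucc) ∧ c = b (Fin.last K) := by
      conv_lhs => rw [← Fin.snoc_init_self b]
      exact Fin.snoc_inj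
    simp only [hsnoc]
    split_ifs with hp
    · simp [hp]
    · simp [hp, PMF.expect_zero]

theorem outputs_apply {X : Type*} (h : X → PMF (Bool × X)) (K : ℕ) (x : X)
    (b : Fin K → Bool) :
    outputs h K x b = listWeight h (fun _ => 1) (List.ofFn b) x := by
  rw [← iterSharp_expect, ← PMF.expect_indicator (outputs h K x) b, outputs, PMF.expect_map]

/-- For an exchangeable coalgebra, the distribution of the first `K` outputs is
invariant under every permutation of the output positions. -/
theorem outputs_perm_invariant {X : Type*} (h : X → PMF (Bool × X))
    (hex : Exchangeable h) (K : ℕ) (x : X) (b : Fin K → Bool) (σ : Equiv.Perm (Fin K)) :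
    outputs h K x (b ∘ σ) = outputs h K x b := by
  rw [outputs_apply, outputs_apply]
  exact hex.listWeight_perm _ (Equiv.Perm.ofFn_comp_perm σ b) x
end

section
/- The beta-binomial channels form a cone over the draw-and-delete chain: for all real α, β > 0, all K ∈ ℕ and all k ≤ K, writing BB_K(α,β)(k) = C(K,k) · B(α+k, β+K−k) / B(α,β), one has ((k+1)/(K+1)) · BB_{K+1}(α,β)(k+1) + ((K+1−k)/(K+1)) · BB_{K+1}(α,β)(k) = BB_K(α,β)(k). -/
open MeasureTheory

/-- The Beta function `B(a,b) = ∫_0^1 x^{a−1}·(1−x)^{b−1} dx`. -/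
noncomputable def betaFn (a b : ℝ) : ℝ :=
  ∫ x in (0 : ℝ)..1, x ^ (a - 1) * (1 - x) ^ (b - 1)

/-- The beta-binomial probability `BB_K(α,β)(k) = C(K,k)·B(α+k,β+K−k)/B(α,β)`. -/
noncomputable def betaBinomial (α β : ℝ) (K k : ℕ) : ℝ :=
  (K.choose k : ℝ) * betaFn (α + k) (β + (K - k : ℕ)) / betaFn α β

open Set in
/-- The integrand of the Beta function is integrable for positive parameters. -/
theorem intervalIntegrable_betaFn {a b : ℝ} (ha : 0 < a) (hb : 0 < b) :
    IntervalIntegrable (fun x : ℝ => x ^ (a - 1) * (1 - x) ^ (b - 1)) volume 0 1 := by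
  have h := (Complex.betaIntegral_convergent (u := a) (v := b) (by simpa) (by simpa)).norm
  refine h.congr_uIoo fun x hx => ?_
  rw [uIoo_of_le zero_le_one] at hx
  have h1 : (1 - (x : ℂ)) = ((1 - x : ℝ) : ℂ) := by push_cast; rfl
  simp only [norm_mul, h1]
  rw [Complex.norm_cpow_eq_rpow_re_of_pos hx.1,
    Complex.norm_cpow_eq_rpow_re_of_pos (sub_pos.2 hx.2)]
  simp

open Set in
/-- Pascal's identity for the Beta function. -/
theorem betaFn_add_one_left_add_betaFn_add_one_right {a b : ℝ} (ha : 0 < a) (hb : 0 < b) :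
    betaFn (a + 1) b + betaFn a (b + 1) = betaFn a b := by
  unfold betaFn
  rw [← intervalIntegral.integral_add (intervalIntegrable_betaFn (by positivity) hb)
    (intervalIntegrable_betaFn ha (by positivity))]
  refine intervalIntegral.integral_congr_uIoo fun x hx => ?_
  rw [uIoo_of_le zero_le_one] at hx
  have hxa : x ^ (a + 1 - 1) = x ^ (a - 1) * x := by
    rw [← Real.rpow_add_one hx.1.ne']; ring_nf
  have hxb : (1 - x) ^ (b + 1 - 1) = (1 - x) ^ (b - 1) * (1 - x) := by
    rw [← Real.rpow_add_one (sub_pos.2 hx.2).ne']; ring_nf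
  simp only [hxa, hxb]
  ring

/-- The beta-binomial channels form a cone over the draw-and-delete chain:
`((k+1)/(K+1))·BB_{K+1}(α,β)(k+1) + ((K+1−k)/(K+1))·BB_{K+1}(α,β)(k) = BB_K(α,β)(k)`. -/
theorem betaBinomial_cone (α β : ℝ) (hα : 0 < α) (hβ : 0 < β) (K k : ℕ) (hk : k ≤ K) :
    (((k : ℝ) + 1) / ((K : ℝ) + 1)) * betaBinomial α β (K + 1) (k + 1)
        + ((((K : ℝ) + 1) - (k : ℝ)) / ((K : ℝ) + 1)) * betaBinomial α β (K + 1) k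
      = betaBinomial α β K k := by
  have hK : (K : ℝ) + 1 ≠ 0 := by positivity
  have hsucc : ((k : ℝ) + 1) / (K + 1) * ((K + 1).choose (k + 1) : ℝ) = K.choose k := by
    have h : ((K : ℝ) + 1) * K.choose k = (K + 1).choose (k + 1) * (k + 1) := by
      exact_mod_cast Nat.add_one_mul_choose_eq K k
    field_simp
    linarith
  have hsame : ((K : ℝ) + 1 - k) / (K + 1) * ((K + 1).choose k : ℝ) = K.choose k := by
    have h : (K.choose k : ℝ) * (K + 1) = (K + 1).choose k * (K + 1 - k) := by
      have := congrArg (Nat.cast (R := ℝ)) (Nat.choose_mul_succ_eq K k)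
      rw [Nat.cast_mul, Nat.cast_mul, Nat.cast_sub (by omega)] at this
      exact_mod_cast this
    field_simp
    linarith
  have hbeta := betaFn_add_one_left_add_betaFn_add_one_right
    (a := α + k) (b := β + (K - k : ℕ)) (by positivity) (by positivity)
  have hsub : K + 1 - k = K - k + 1 := by omega
  simp only [betaBinomial, Nat.add_sub_add_right, hsub, Nat.cast_add, Nat.cast_one, ← add_assoc]
  rw [← hbeta, mul_div_assoc, mul_div_assoc, mul_div_assoc, ← mul_assoc, ← mul_assoc, hsucc, hsame]
  ring
end

section
/- Let (ω_K)_{K ∈ ℕ} with ω_K a probability distribution on {0,…,K}, satisfying the cone condition ω_K(i) = ((i+1)/(K+1)) · ω_{K+1}(i+1) + ((K+1−i)/(K+1)) · ω_{K+1}(i) for all K and i ≤ K. Define b_K = ω_K(K). Then for all k, n ∈ ℕ: ω_{k+n}(n) = C(k+n, n) · (−1)^k · (Δ^k b)_n. In particular the sequence (b_K) is completely monotone: (−1)^k · (Δ^k b)_n ≥ 0 for all n, k. -/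
open Finset

/-- The forward difference operator on sequences: `(Δa)_n = a_{n+1} − a_n`. -/
def fdiff (a : ℕ → ℝ) : ℕ → ℝ := fun n => a (n + 1) - a n

/-- If a triangular array satisfies the draw-and-delete recursion, then its entries are
the binomially weighted iterated differences of its diagonal. -/
theorem cone_eq_choose_mul_fdiff (ω : ℕ → ℕ → ℝ)
    (hcone : ∀ K i, i ≤ K →
      ω K i = (((i : ℝ) + 1) / ((K : ℝ) + 1)) * ω (K + 1) (i + 1)
        + ((((K : ℝ) + 1) - (i : ℝ)) / ((K : ℝ) + 1)) * ω (K + 1) i) (k n : ℕ) :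
    ω (k + n) n = ((k + n).choose n : ℝ) * (-1 : ℝ) ^ k * (fdiff^[k] (fun K => ω K K)) n := by
  induction k generalizing n with
  | zero => simp
  | succ k ih =>
    have hrec := hcone (k + n) n (Nat.le_add_left n k)
    have hn := ih n
    have hn1 := ih (n + 1)
    have hsucc : (((k + n : ℕ) : ℝ) + 1) * ((k + n).choose n : ℝ)
        = ((k + n + 1).choose (n + 1) : ℝ) * ((n : ℝ) + 1) := by
      exact_mod_cast Nat.add_one_mul_choose_eq (k + n) n
    have hsame : ((k + n).choose n : ℝ) * (((k + n : ℕ) : ℝ) + 1)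
        = ((k + n + 1).choose n : ℝ) * ((k : ℝ) + 1) := by
      have h := Nat.choose_mul_succ_eq (k + n) n
      rw [show k + n + 1 - n = k + 1 by omega] at h
      exact_mod_cast h
    rw [show k + (n + 1) = k + n + 1 by ring] at hn1
    rw [Function.iterate_succ_apply', show k + 1 + n = k + n + 1 by ring]
    generalize fdiff^[k] (fun K => ω K K) = f at *
    have hK : ((k + n : ℕ) : ℝ) + 1 ≠ 0 := by positivity
    have hk : (k : ℝ) + 1 ≠ 0 := by positivity
    rw [hn, hn1] at hrec
    field_simp at hrec
    apply mul_left_cancel₀ hk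
    simp only [fdiff, pow_succ]
    push_cast at hrec hsucc hsame
    linear_combination -hrec + (-1) ^ k * f (n + 1) * hsucc
      + (-1) ^ k * (f n - f (n + 1)) * hsame

/-- For a cone `(ω_K)` of probability distributions over the draw-and-delete chain,
the numbers `b_K = ω_K(K)` determine all the distributions via
`ω_{k+n}(n) = C(k+n,n)·(−1)^k·(Δ^k b)_n`; in particular `(b_K)` is completely monotone. -/
theorem cone_eq_fdiff_and_completelyMonotone
    (ω : ℕ → ℕ → ℝ)
    (hpos : ∀ K i, 0 ≤ ω K i)
    (hsupp : ∀ K i, K < i → ω K i = 0)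
    (hsum : ∀ K, ∑ i ∈ Finset.range (K + 1), ω K i = 1)
    (hcone : ∀ K i, i ≤ K →
      ω K i = (((i : ℝ) + 1) / ((K : ℝ) + 1)) * ω (K + 1) (i + 1)
        + ((((K : ℝ) + 1) - (i : ℝ)) / ((K : ℝ) + 1)) * ω (K + 1) i) :
    ∀ k n : ℕ,
      ω (k + n) n = ((k + n).choose n : ℝ) * (-1 : ℝ) ^ k * (fdiff^[k] (fun K => ω K K)) n
        ∧ 0 ≤ (-1 : ℝ) ^ k * (fdiff^[k] (fun K => ω K K)) n := by
  intro k n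
  have h := cone_eq_choose_mul_fdiff ω hcone k n
  refine ⟨h, ?_⟩
  have hchoose : (0 : ℝ) < (k + n).choose n := by
    exact_mod_cast Nat.choose_pos (Nat.le_add_left n k)
  refine nonneg_of_mul_nonneg_right ?_ hchoose
  rw [← mul_assoc, ← h]
  exact hpos _ _
end

section
/- (Hausdorff moment theorem) A sequence a : ℕ → ℝ of non-negative reals is completely monotone if and only if there exists a finite Borel measure μ on [0,1] with a_n = ∫_0^1 x^n dμ(x) for all n; moreover such a measure μ is unique. -/
open MeasureTheory

/-- A sequence is completely monotone if `(−1)^k·(Δ^k a)_n ≥ 0` for all `n, k`. -/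
def CompletelyMonotone (a : ℕ → ℝ) : Prop :=
  ∀ n k : ℕ, 0 ≤ (-1 : ℝ) ^ k * (fdiff^[k] a) n

open Polynomial Filter Topology unitInterval

/-- The linear functional on real polynomials sending `X ^ n` to `a n`. -/
noncomputable def momentFunctional (a : ℕ → ℝ) : ℝ[X] →ₗ[ℝ] ℝ :=
  Polynomial.lsum fun n => LinearMap.mulRight ℝ (a n)

lemma momentFunctional_X_pow (a : ℕ → ℝ) (n : ℕ) : momentFunctional a (X ^ n) = a n := by
  rw [← monomial_one_right_eq_X_pow]
  simp [momentFunctional, Polynomial.sum_monomial_index]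

lemma momentFunctional_X_pow_mul (a : ℕ → ℝ) (n k : ℕ) :
    momentFunctional a (X ^ n * (1 - X) ^ k) = (-1) ^ k * (fdiff^[k] a) n := by
  induction k generalizing n with
  | zero => simp [momentFunctional_X_pow]
  | succ k ih =>
    have h : (X ^ n * (1 - X) ^ (k + 1) : ℝ[X]) =
        X ^ n * (1 - X) ^ k - X ^ (n + 1) * (1 - X) ^ k := by ring
    rw [h, map_sub, ih, ih, Function.iterate_succ_apply', fdiff]
    ring

lemma integrable_continuousMap (μ : Measure I) [IsFiniteMeasure μ] (f : C(I, ℝ)) :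
    Integrable f μ :=
  (BoundedContinuousFunction.mkOfCompact f).integrable μ

lemma momentFunctional_eq_integral {a : ℕ → ℝ} {μ : Measure I} [IsFiniteMeasure μ]
    (h : ∀ n, a n = ∫ x, (x : ℝ) ^ n ∂μ) (p : ℝ[X]) :
    momentFunctional a p = ∫ x, p.eval (x : ℝ) ∂μ := by
  induction p using Polynomial.induction_on' with
  | add p q hp hq =>
    simp only [map_add, eval_add, hp, hq]
    exact (integral_add (integrable_continuousMap μ (p.toContinuousMapOn I))
      (integrable_continuousMap μ (q.toContinuousMapOn I))).symm
  | monomial n c =>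
    rw [← C_mul_X_pow_eq_monomial, ← smul_eq_C_mul, map_smul, momentFunctional_X_pow, h]
    simp [integral_const_mul]

lemma completelyMonotone_of_moments {a : ℕ → ℝ} {μ : Measure I} [IsFiniteMeasure μ]
    (h : ∀ n, a n = ∫ x, (x : ℝ) ^ n ∂μ) : CompletelyMonotone a := by
  intro n k
  rw [← momentFunctional_X_pow_mul, momentFunctional_eq_integral h]
  refine integral_nonneg fun x => ?_
  have h₀ : (0 : ℝ) ≤ x := x.2.1
  have h₁ : (0 : ℝ) ≤ 1 - x := sub_nonneg.2 x.2.2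
  simp only [eval_mul, eval_pow, eval_X, eval_sub, eval_one, Pi.zero_apply]
  positivity

lemma continuous_integral_continuousMap (μ : Measure I) [IsFiniteMeasure μ] :
    Continuous fun f : C(I, ℝ) => ∫ x, f x ∂μ := by
  refine (continuous_integral.comp (ContinuousMap.toLp 1 μ ℝ).continuous).congr fun f => ?_
  exact integral_congr_ae (ContinuousMap.coeFn_toLp μ f)

lemma measure_eq_of_moments_eq {μ ν : Measure I} [IsFiniteMeasure μ] [IsFiniteMeasure ν]
    (h : ∀ n : ℕ, ∫ x, (x : ℝ) ^ n ∂μ = ∫ x, (x : ℝ) ^ n ∂ν) : μ = ν := by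
  refine ext_of_forall_integral_eq_of_IsFiniteMeasure fun f => ?_
  have hclosed : IsClosed {g : C(I, ℝ) | ∫ x, g x ∂μ = ∫ x, g x ∂ν} :=
    isClosed_eq (continuous_integral_continuousMap μ) (continuous_integral_continuousMap ν)
  have hpoly : (polynomialFunctions I : Set C(I, ℝ)) ⊆
      {g : C(I, ℝ) | ∫ x, g x ∂μ = ∫ x, g x ∂ν} := by
    rw [polynomialFunctions_coe]
    rintro _ ⟨p, rfl⟩
    exact (momentFunctional_eq_integral (fun _ => rfl) p).symm.trans
      (momentFunctional_eq_integral h p)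
  exact closure_minimal hpoly hclosed
    (continuousMap_mem_polynomialFunctions_closure 0 1 f.toContinuousMap)

lemma sum_choose_mul_bernsteinPolynomial {n m : ℕ} (h : m ≤ n) :
    ∑ k ∈ Finset.range (n + 1), (k.choose m : ℝ) • bernsteinPolynomial ℝ n k =
      (n.choose m : ℝ) • (X ^ m : ℝ[X]) := by
  obtain ⟨p, rfl⟩ := Nat.exists_eq_add_of_le h
  rw [add_assoc, Finset.sum_range_add, Finset.sum_eq_zero, zero_add]
  · have hb : ∑ j ∈ Finset.range (p + 1), bernsteinPolynomial ℝ p j = 1 :=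
      bernsteinPolynomial.sum ℝ p
    rw [← mul_one (X ^ m : ℝ[X]), ← hb, Finset.mul_sum, Finset.smul_sum]
    refine Finset.sum_congr rfl fun j _ => ?_
    have hc := Nat.choose_mul (n := m + p) (k := m + j) (s := m) (Nat.le_add_right m j)
    simp only [Nat.add_sub_cancel_left] at hc
    have hc' : (((m + p).choose (m + j) : ℕ) : ℝ[X]) * ((m + j).choose m : ℕ) =
        ((m + p).choose m : ℕ) * (p.choose j : ℕ) := by exact_mod_cast hc
    simp only [bernsteinPolynomial, smul_eq_C_mul, map_natCast, Nat.add_sub_add_left]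
    linear_combination (X ^ (m + j) * (1 - X) ^ (p - j)) * hc'
  · intro k hk
    simp [Nat.choose_eq_zero_of_lt (Finset.mem_range.1 hk)]

lemma sum_momentFunctional_mul_choose (a : ℕ → ℝ) {n m : ℕ} (hm : m ≤ n) :
    ∑ k : Fin (n + 1), momentFunctional a (bernsteinPolynomial ℝ n k) *
      ((((k : ℕ).choose m : ℕ) : ℝ) / n.choose m) = a m := by
  have hs := congrArg (momentFunctional a) (sum_choose_mul_bernsteinPolynomial hm)
  simp only [map_sum, map_smul, momentFunctional_X_pow, smul_eq_mul] at hs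
  have hne : (n.choose m : ℝ) ≠ 0 := by exact_mod_cast (Nat.choose_pos hm).ne'
  rw [Finset.sum_range] at hs
  rw [← mul_right_inj' hne, ← hs, Finset.mul_sum]
  refine Finset.sum_congr rfl fun k _ => ?_
  field_simp

lemma sum_momentFunctional (a : ℕ → ℝ) (n : ℕ) :
    ∑ k : Fin (n + 1), momentFunctional a (bernsteinPolynomial ℝ n k) = a 0 := by
  simpa using sum_momentFunctional_mul_choose a (Nat.zero_le n)

lemma choose_div_choose_succ {n k m : ℕ} (hm : m < n) :
    (k.choose (m + 1) : ℝ) / n.choose (m + 1) =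
      (k.choose m : ℝ) / n.choose m * (((k : ℝ) - m) / ((n : ℝ) - m)) := by
  have hmn : (m : ℝ) < n := by exact_mod_cast hm
  have key (l : ℕ) : (l.choose (m + 1) : ℝ) * (m + 1) = l.choose m * ((l : ℝ) - m) := by
    rcases le_or_gt m l with h | h
    · rw [← Nat.cast_sub h]
      exact_mod_cast Nat.choose_succ_right_eq l m
    · simp [Nat.choose_eq_zero_of_lt h, Nat.choose_eq_zero_of_lt (h.trans m.lt_succ_self)]
  have h₁ : (n.choose (m + 1) : ℝ) ≠ 0 := by
    exact_mod_cast (Nat.choose_pos (Nat.succ_le_of_lt hm)).ne'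
  have h₂ : (n.choose m : ℝ) ≠ 0 := by exact_mod_cast (Nat.choose_pos hm.le).ne'
  have h₃ : (n : ℝ) - m ≠ 0 := (sub_pos.2 hmn).ne'
  have h₄ : (m : ℝ) + 1 ≠ 0 := by positivity
  rw [div_mul_div_comm, ← key k, ← key n, mul_div_mul_right _ _ h₄]

lemma abs_choose_div_choose_sub_pow_le {n k m : ℕ} (hm : m ≤ n) (hk : k ≤ n) :
    |(k.choose m : ℝ) / n.choose m - ((k : ℝ) / n) ^ m| ≤
      ∑ i ∈ Finset.range m, (i : ℝ) / ((n : ℝ) - i) := by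
  induction m with
  | zero => simp
  | succ m ih =>
    have hmn : (m : ℝ) < n := by exact_mod_cast hm
    have hn : (0 : ℝ) < n := m.cast_nonneg.trans_lt hmn
    have hkn : (k : ℝ) ≤ n := by exact_mod_cast hk
    have hr₀ : (0 : ℝ) ≤ (k : ℝ) / n := by positivity
    have hr₁ : (k : ℝ) / n ≤ 1 := (div_le_one hn).2 hkn
    have hq₀ : (0 : ℝ) ≤ (k.choose m : ℝ) / n.choose m := by positivity
    have hq₁ : (k.choose m : ℝ) / n.choose m ≤ 1 :=
      div_le_one_of_le₀ (by exact_mod_cast Nat.choose_le_choose m hk) (by positivity)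
    have hd : (k : ℝ) / n - ((k : ℝ) - m) / ((n : ℝ) - m) =
        m / ((n : ℝ) - m) * (1 - (k : ℝ) / n) := by
      have := (sub_pos.2 hmn).ne'
      field_simp
      ring
    have hs : (0 : ℝ) ≤ m / ((n : ℝ) - m) := div_nonneg m.cast_nonneg (sub_pos.2 hmn).le
    rw [choose_div_choose_succ hm, Finset.sum_range_succ]
    generalize (k.choose m : ℝ) / n.choose m = q at *
    generalize ((k : ℝ) - m) / ((n : ℝ) - m) = t at *
    generalize (k : ℝ) / n = r at *
    generalize (m : ℝ) / ((n : ℝ) - m) = s at *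
    have e : q * t - r ^ (m + 1) = r * (q - r ^ m) + q * (t - r) := by ring
    have h₁ : |r * (q - r ^ m)| ≤ |q - r ^ m| := by
      rw [abs_mul, abs_of_nonneg hr₀]
      exact mul_le_of_le_one_left (abs_nonneg _) hr₁
    have h₂ : |q * (t - r)| ≤ s := by
      rw [abs_mul, abs_of_nonneg hq₀, abs_sub_comm, hd,
        abs_of_nonneg (mul_nonneg hs (sub_nonneg.2 hr₁))]
      calc q * (s * (1 - r)) ≤ s * (1 - r) :=
            mul_le_of_le_one_left (mul_nonneg hs (sub_nonneg.2 hr₁)) hq₁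
        _ ≤ s := mul_le_of_le_one_right hs (by linarith)
    rw [e]
    exact (abs_add_le _ _).trans (add_le_add (h₁.trans (ih (Nat.le_of_succ_le hm))) h₂)

lemma tendsto_sum_div_sub (m : ℕ) :
    Tendsto (fun n : ℕ => ∑ i ∈ Finset.range m, (i : ℝ) / ((n : ℝ) - i)) atTop (𝓝 0) := by
  rw [← Finset.sum_const_zero (s := Finset.range m)]
  exact tendsto_finsetSum _ fun i _ => tendsto_const_nhds.div_atTop
    (tendsto_atTop_add_const_right _ _ tendsto_natCast_atTop_atTop)

/-- The measure on the points `k / n` with weights the values of the moment functional on the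
Bernstein polynomials of degree `n`. -/
noncomputable def bernsteinMeasure (a : ℕ → ℝ) (n : ℕ) : Measure I :=
  ∑ k : Fin (n + 1), ENNReal.ofReal (momentFunctional a (bernsteinPolynomial ℝ n k)) •
    Measure.dirac (bernstein.z k)

instance (a : ℕ → ℝ) (n : ℕ) : IsFiniteMeasure (bernsteinMeasure a n) := by
  unfold bernsteinMeasure
  have (k : Fin (n + 1)) : IsFiniteMeasure
      (ENNReal.ofReal (momentFunctional a (bernsteinPolynomial ℝ n k)) •
        Measure.dirac (bernstein.z k)) :=
    Measure.smul_finite _ ENNReal.ofReal_ne_top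
  infer_instance

namespace CompletelyMonotone

variable {a : ℕ → ℝ}

lemma momentFunctional_bernsteinPolynomial_nonneg (h : CompletelyMonotone a) (n k : ℕ) :
    0 ≤ momentFunctional a (bernsteinPolynomial ℝ n k) := by
  have : bernsteinPolynomial ℝ n k = (n.choose k : ℝ) • (X ^ k * (1 - X) ^ (n - k)) := by
    simp [bernsteinPolynomial, smul_eq_C_mul, mul_assoc]
  rw [this, map_smul, momentFunctional_X_pow_mul, smul_eq_mul]
  exact mul_nonneg (Nat.cast_nonneg _) (h k (n - k))

lemma integral_bernsteinMeasure (h : CompletelyMonotone a) (n : ℕ) (f : C(I, ℝ)) :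
    ∫ x, f x ∂bernsteinMeasure a n = ∑ k : Fin (n + 1),
      momentFunctional a (bernsteinPolynomial ℝ n k) * f (bernstein.z k) := by
  rw [bernsteinMeasure, integral_finsetSum_measure]
  · simp [integral_smul_measure, h.momentFunctional_bernsteinPolynomial_nonneg]
  · intro k _
    exact (integrable_continuousMap _ f).smul_measure ENNReal.ofReal_ne_top

lemma tendsto_integral_pow_bernsteinMeasure (h : CompletelyMonotone a) (m : ℕ) :
    Tendsto (fun n => ∫ x : I, (x : ℝ) ^ m ∂bernsteinMeasure a n) atTop (𝓝 (a m)) := by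
  rw [tendsto_iff_dist_tendsto_zero]
  refine squeeze_zero' (Eventually.of_forall fun _ => dist_nonneg) ?_
    (by simpa using (tendsto_sum_div_sub m).const_mul (a 0))
  filter_upwards [eventually_ge_atTop m] with n hn
  have hi := h.integral_bernsteinMeasure n ((X ^ m : ℝ[X]).toContinuousMapOn I)
  simp only [toContinuousMapOn_apply, toContinuousMap_apply, eval_pow, eval_X] at hi
  rw [hi, dist_comm, Real.dist_eq]
  nth_rewrite 1 [← sum_momentFunctional_mul_choose a hn]
  rw [← Finset.sum_sub_distrib, ← sum_momentFunctional a n, Finset.sum_mul]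
  refine (Finset.abs_sum_le_sum_abs _ _).trans (Finset.sum_le_sum fun k _ => ?_)
  rw [← mul_sub, abs_mul, abs_of_nonneg (h.momentFunctional_bernsteinPolynomial_nonneg n k)]
  exact mul_le_mul_of_nonneg_left (abs_choose_div_choose_sub_pow_le hn k.is_le)
    (h.momentFunctional_bernsteinPolynomial_nonneg n k)

lemma bernsteinMeasure_univ (h : CompletelyMonotone a) (n : ℕ) :
    bernsteinMeasure a n Set.univ = ENNReal.ofReal (a 0) := by
  rw [← sum_momentFunctional a n,
    ENNReal.ofReal_sum_of_nonneg fun (k : Fin (n + 1)) _ =>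
      h.momentFunctional_bernsteinPolynomial_nonneg n k]
  simp [bernsteinMeasure]

lemma exists_measure (h : CompletelyMonotone a) :
    ∃ μ : Measure I, IsFiniteMeasure μ ∧ ∀ n, a n = ∫ x, (x : ℝ) ^ n ∂μ := by
  let ν : ℕ → FiniteMeasure I := fun n => ⟨bernsteinMeasure a n, inferInstance⟩
  let U : Ultrafilter (FiniteMeasure I) := (hyperfilter ℕ).map ν
  have hU : {μ : FiniteMeasure I | μ.mass ≤ (a 0).toNNReal} ∈ U := by
    refine Ultrafilter.mem_map.2 (Filter.univ_mem' fun n => ?_)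
    change (bernsteinMeasure a n Set.univ).toNNReal ≤ (a 0).toNNReal
    rw [h.bernsteinMeasure_univ]
    rfl
  obtain ⟨μ, -, hμ⟩ :=
    (isCompact_setOfPred_finiteMeasure_le_of_compactSpace I _).ultrafilter_le_nhds' U hU
  have hν : Tendsto ν (hyperfilter ℕ) (𝓝 μ) := hμ
  refine ⟨μ, inferInstance, fun n => ?_⟩
  exact tendsto_nhds_unique
    ((h.tendsto_integral_pow_bernsteinMeasure n).mono_left Nat.hyperfilter_le_atTop)
    (FiniteMeasure.tendsto_iff_forall_integral_tendsto.1 hν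
      (BoundedContinuousFunction.mkOfCompact ⟨fun x : I => (x : ℝ) ^ n, by fun_prop⟩))

end CompletelyMonotone

/-- Hausdorff's moment theorem: a sequence of non-negative reals is completely monotone
iff it is the moment sequence of a finite Borel measure on `[0,1]`; moreover such a
measure is unique. -/
theorem hausdorff_moment_theorem (a : ℕ → ℝ) (ha : ∀ n, 0 ≤ a n) :
    (CompletelyMonotone a ↔
      ∃ μ : Measure (Set.Icc (0 : ℝ) 1), IsFiniteMeasure μ ∧
        ∀ n, a n = ∫ x, (x : ℝ) ^ n ∂μ)
    ∧ ∀ μ₁ μ₂ : Measure (Set.Icc (0 : ℝ) 1), IsFiniteMeasure μ₁ → IsFiniteMeasure μ₂ →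
        (∀ n, a n = ∫ x, (x : ℝ) ^ n ∂μ₁) → (∀ n, a n = ∫ x, (x : ℝ) ^ n ∂μ₂) →
        μ₁ = μ₂ := by
  refine ⟨⟨fun h => h.exists_measure, ?_⟩, ?_⟩
  · rintro ⟨μ, _, h⟩
    exact completelyMonotone_of_moments h
  · intro μ₁ μ₂ _ _ h₁ h₂
    exact measure_eq_of_moments_eq fun n => (h₁ n).symm.trans (h₂ n)
end

section
/- (De Finetti, pointwise limit form) Let (ω_K)_{K ∈ ℕ} with ω_K a probability distribution on {0,…,K}, satisfying the cone condition ω_K(i) = ((i+1)/(K+1)) · ω_{K+1}(i+1) + ((K+1−i)/(K+1)) · ω_{K+1}(i) for all K and i ≤ K. Then there exists a unique Borel probability measure μ on [0,1] such that for all K and all k ≤ K: ω_K(k) = ∫_0^1 C(K,k) · x^k · (1−x)^{K−k} dμ(x). -/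
open MeasureTheory Finset Filter Topology

theorem pow_le_descFactorial_add (n i K : ℕ) (h : i ≤ n) :
    n * i ^ K ≤ n * i.descFactorial K + K ^ 2 * n ^ K := by
  induction K with
  | zero => simp
  | succ K ih =>
    have hstep : i * i.descFactorial K ≤ i.descFactorial (K + 1) + K * n ^ K := by
      rw [Nat.descFactorial_succ]
      calc i * i.descFactorial K ≤ ((i - K) + K) * i.descFactorial K := by gcongr; omega
        _ = (i - K) * i.descFactorial K + K * i.descFactorial K := add_mul _ _ _
        _ ≤ _ := by
          gcongr
          exact (i.descFactorial_le_pow K).trans (by gcongr)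
    calc n * i ^ (K + 1) = i * (n * i ^ K) := by ring
      _ ≤ i * (n * i.descFactorial K + K ^ 2 * n ^ K) := by gcongr
      _ = n * (i * i.descFactorial K) + K ^ 2 * (i * n ^ K) := by ring
      _ ≤ n * (i.descFactorial (K + 1) + K * n ^ K) + K ^ 2 * (n * n ^ K) := by gcongr
      _ = n * i.descFactorial (K + 1) + (K ^ 2 + K) * n ^ (K + 1) := by ring
      _ ≤ _ := by gcongr; nlinarith

theorem abs_descFactorial_div_pow_sub_le {n i : ℕ} (K : ℕ) (hn : n ≠ 0) (h : i ≤ n) :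
    |(i.descFactorial K : ℝ) / n ^ K - ((i : ℝ) / n) ^ K| ≤ (K : ℝ) ^ 2 / n := by
  have hn' : (0 : ℝ) < n := by positivity
  have h1 : (n : ℝ) * i ^ K ≤ n * i.descFactorial K + K ^ 2 * n ^ K := by
    exact_mod_cast pow_le_descFactorial_add n i K h
  have h2 : (i.descFactorial K : ℝ) ≤ i ^ K := by exact_mod_cast i.descFactorial_le_pow K
  rw [div_pow, ← sub_div, abs_div, abs_of_nonpos (sub_nonpos.2 h2),
    abs_of_pos (by positivity : (0 : ℝ) < n ^ K), div_le_div_iff₀ (by positivity) hn']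
  linarith

theorem cast_descFactorial_succ (i K : ℕ) :
    (i.descFactorial (K + 1) : ℝ) = ((i : ℝ) - K) * i.descFactorial K := by
  rcases le_or_gt K i with h | h
  · rw [Nat.descFactorial_succ, Nat.cast_mul, Nat.cast_sub h]
  · rw [Nat.descFactorial_of_lt h, Nat.descFactorial_of_lt (h.trans K.lt_succ_self)]
    simp

/-- The cone condition preserves normalized factorial moments. -/
theorem sum_mul_descFactorial_of_cone {ω : ℕ → ℕ → ℝ}
    (hcone : ∀ K i, i ≤ K →
      ω K i = (((i : ℝ) + 1) / ((K : ℝ) + 1)) * ω (K + 1) (i + 1)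
        + ((((K : ℝ) + 1) - (i : ℝ)) / ((K : ℝ) + 1)) * ω (K + 1) i)
    {K n : ℕ} (hn : K ≤ n) :
    ∑ i ∈ range (n + 1), ω n i * i.descFactorial K = n.descFactorial K * ω K K := by
  induction n, hn using Nat.le_induction with
  | base =>
    rw [sum_range_succ, sum_eq_zero, zero_add, mul_comm]
    intro i hi
    simp [Nat.descFactorial_of_lt (mem_range.1 hi)]
  | succ n hn ih =>
    have hsum : ((n : ℝ) + 1) * ∑ i ∈ range (n + 1), ω n i * i.descFactorial K =
        ((n : ℝ) + 1 - K) * ∑ i ∈ range (n + 1 + 1), ω (n + 1) i * i.descFactorial K := by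
      have hsplit : ∀ i ∈ range (n + 1), ((n : ℝ) + 1) * (ω n i * i.descFactorial K) =
          ω (n + 1) (i + 1) * (i + 1).descFactorial (K + 1) +
            ((n : ℝ) + 1 - i) * (ω (n + 1) i * i.descFactorial K) := by
        intro i hi
        rw [hcone n i (Nat.lt_succ_iff.1 (mem_range.1 hi)), Nat.succ_descFactorial_succ]
        push_cast
        field_simp
      have hlast : ∑ i ∈ range (n + 1), ((n : ℝ) + 1 - i) * (ω (n + 1) i * i.descFactorial K) =
          ∑ i ∈ range (n + 1 + 1), ((n : ℝ) + 1 - i) * (ω (n + 1) i * i.descFactorial K) := by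
        rw [sum_range_succ _ (n + 1)]
        simp
      have hfirst : ∑ i ∈ range (n + 1), ω (n + 1) (i + 1) * (i + 1).descFactorial (K + 1) =
          ∑ i ∈ range (n + 1 + 1), ω (n + 1) i * i.descFactorial (K + 1) := by
        rw [sum_range_succ' _ (n + 1)]
        simp
      rw [mul_sum, sum_congr rfl hsplit, sum_add_distrib, hfirst, hlast, ← sum_add_distrib, mul_sum]
      refine sum_congr rfl fun i _ => ?_
      rw [cast_descFactorial_succ]
      ring
    have hfac : ((n : ℝ) + 1 - K) * (n + 1).descFactorial K = (n + 1) * n.descFactorial K := by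
      rw [← Nat.cast_add_one, ← Nat.cast_sub (by omega)]
      exact_mod_cast Nat.succ_descFactorial n K
    have hne : (n : ℝ) + 1 - K ≠ 0 := by
      have : (K : ℝ) ≤ n := by exact_mod_cast hn
      linarith
    apply mul_left_cancel₀ hne
    rw [← hsum, ih, ← mul_assoc, ← mul_assoc, hfac]

theorem tendsto_sum_mul_pow_of_cone {ω : ℕ → ℕ → ℝ}
    (hpos : ∀ K i, 0 ≤ ω K i)
    (hsum : ∀ K, ∑ i ∈ range (K + 1), ω K i = 1)
    (hcone : ∀ K i, i ≤ K →
      ω K i = (((i : ℝ) + 1) / ((K : ℝ) + 1)) * ω (K + 1) (i + 1)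
        + ((((K : ℝ) + 1) - (i : ℝ)) / ((K : ℝ) + 1)) * ω (K + 1) i)
    (K : ℕ) :
    Tendsto (fun n : ℕ => ∑ i ∈ range (n + 1), ω n i * ((i : ℝ) / n) ^ K) atTop (𝓝 (ω K K)) := by
  have hbound : Tendsto (fun n : ℕ => (K : ℝ) ^ 2 / n) atTop (𝓝 0) :=
    tendsto_const_div_atTop_nhds_zero_nat _
  have hratio : Tendsto (fun n : ℕ => (n.descFactorial K : ℝ) / n ^ K) atTop (𝓝 1) := by
    rw [tendsto_iff_norm_sub_tendsto_zero]
    refine squeeze_zero' (.of_forall fun _ => norm_nonneg _) ?_ hbound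
    filter_upwards [eventually_ne_atTop 0] with n hn
    simpa [hn] using abs_descFactorial_div_pow_sub_le K hn le_rfl
  have hlim : Tendsto (fun n : ℕ => (n.descFactorial K : ℝ) / n ^ K * ω K K) atTop
      (𝓝 (ω K K)) := by
    simpa using hratio.mul_const (ω K K)
  refine hlim.congr_dist (squeeze_zero' (.of_forall fun _ => dist_nonneg) ?_ hbound)
  filter_upwards [eventually_ne_atTop 0, eventually_ge_atTop K] with n hn hK
  rw [Real.dist_eq, div_mul_eq_mul_div, ← sum_mul_descFactorial_of_cone hcone hK, sum_div,
    ← sum_sub_distrib]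
  calc _ ≤ ∑ i ∈ range (n + 1), ω n i * ((K : ℝ) ^ 2 / n) := by
        refine (abs_sum_le_sum_abs _ _).trans (sum_le_sum fun i hi => ?_)
        rw [mul_div_assoc, ← mul_sub, abs_mul, abs_of_nonneg (hpos n i)]
        exact mul_le_mul_of_nonneg_left
          (abs_descFactorial_div_pow_sub_le K hn (Nat.lt_succ_iff.1 (mem_range.1 hi))) (hpos n i)
    _ = _ := by rw [← sum_mul, hsum, one_mul]

theorem integrable_unitInterval (μ : Measure (Set.Icc (0 : ℝ) 1)) [IsFiniteMeasure μ]
    (f : C(Set.Icc (0 : ℝ) 1, ℝ)) : Integrable f μ :=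
  f.continuous.integrable_of_hasCompactSupport (HasCompactSupport.of_compactSpace f)

/-- A cone is determined by its diagonal. -/
theorem cone_eq_of_diagonal_eq {ω η : ℕ → ℕ → ℝ}
    (hω : ∀ K i, i ≤ K →
      ω K i = (((i : ℝ) + 1) / ((K : ℝ) + 1)) * ω (K + 1) (i + 1)
        + ((((K : ℝ) + 1) - (i : ℝ)) / ((K : ℝ) + 1)) * ω (K + 1) i)
    (hη : ∀ K i, i ≤ K →
      η K i = (((i : ℝ) + 1) / ((K : ℝ) + 1)) * η (K + 1) (i + 1)
        + ((((K : ℝ) + 1) - (i : ℝ)) / ((K : ℝ) + 1)) * η (K + 1) i)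
    (hdiag : ∀ K, ω K K = η K K) {K k : ℕ} (hk : k ≤ K) : ω K k = η K k := by
  obtain ⟨j, rfl⟩ := Nat.exists_eq_add_of_le hk
  clear hk
  induction j generalizing k with
  | zero => exact hdiag k
  | succ j ih =>
    have h1 := hω (k + j) k (by omega)
    have h2 := hη (k + j) k (by omega)
    have h3 := ih (k := k + 1)
    rw [show k + 1 + j = k + j + 1 by ring] at h3
    rw [ih, h2, h3, add_right_inj] at h1
    refine (mul_left_cancel₀ ?_ h1).symm
    push_cast
    have : (0 : ℝ) < (k + j + 1 - k) / (k + j + 1) := by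
      rw [show (k + j + 1 - k : ℝ) = j + 1 by ring]
      positivity
    exact this.ne'

theorem bernstein_cone (x : Set.Icc (0 : ℝ) 1) {K i : ℕ} (h : i ≤ K) :
    bernstein K i x = (((i : ℝ) + 1) / ((K : ℝ) + 1)) * bernstein (K + 1) (i + 1) x
      + ((((K : ℝ) + 1) - (i : ℝ)) / ((K : ℝ) + 1)) * bernstein (K + 1) i x := by
  have h1 : ((K : ℝ) + 1) * K.choose i = (K + 1).choose (i + 1) * (i + 1) := by
    exact_mod_cast Nat.add_one_mul_choose_eq K i
  have h2 : ((K : ℝ) + 1) * K.choose i = (K + 1).choose i * (K + 1 - i) := by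
    rw [← Nat.cast_add_one, ← Nat.cast_sub (by omega)]
    exact_mod_cast (mul_comm _ _).trans (Nat.choose_mul_succ_eq K i)
  have hK : (K : ℝ) + 1 ≠ 0 := by positivity
  simp only [bernstein_apply]
  rw [Nat.add_sub_add_right, Nat.sub_add_comm h, pow_succ, pow_succ]
  field_simp
  linear_combination (x : ℝ) ^ i * (1 - (x : ℝ)) ^ (K - i) * ((x : ℝ) * h1 + (1 - (x : ℝ)) * h2)

theorem integral_bernstein_cone (μ : Measure (Set.Icc (0 : ℝ) 1)) [IsFiniteMeasure μ]
    {K i : ℕ} (h : i ≤ K) :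
    ∫ x, bernstein K i x ∂μ =
      (((i : ℝ) + 1) / ((K : ℝ) + 1)) * ∫ x, bernstein (K + 1) (i + 1) x ∂μ
        + ((((K : ℝ) + 1) - (i : ℝ)) / ((K : ℝ) + 1)) * ∫ x, bernstein (K + 1) i x ∂μ := by
  simp_rw [bernstein_cone _ h]
  rw [integral_add ((integrable_unitInterval μ _).const_mul _)
    ((integrable_unitInterval μ _).const_mul _), integral_const_mul, integral_const_mul]

theorem measure_eq_of_integral_bernstein_eq {μ ν : Measure (Set.Icc (0 : ℝ) 1)}
    [IsProbabilityMeasure μ] [IsProbabilityMeasure ν]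
    (h : ∀ K k : ℕ, k ≤ K → ∫ x, bernstein K k x ∂μ = ∫ x, bernstein K k x ∂ν) : μ = ν := by
  have hlim (ρ : Measure (Set.Icc (0 : ℝ) 1)) [IsProbabilityMeasure ρ]
      (f : C(Set.Icc (0 : ℝ) 1, ℝ)) :
      Tendsto (fun n : ℕ => ∑ k : Fin (n + 1), (∫ x, bernstein n k x ∂ρ) * f (bernstein.z k))
        atTop (𝓝 (∫ x, f x ∂ρ)) := by
    have heq (n : ℕ) : ∑ k : Fin (n + 1), (∫ x, bernstein n k x ∂ρ) * f (bernstein.z k) =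
        ∫ x, bernsteinApproximation n f x ∂ρ := by
      simp_rw [bernsteinApproximation.apply, smul_eq_mul]
      rw [integral_finsetSum _ fun k _ => (integrable_unitInterval ρ _).mul_const _]
      simp_rw [integral_mul_const]
    simp_rw [heq]
    have hf := tendsto_iff_norm_sub_tendsto_zero.1 (bernsteinApproximation_uniform f)
    refine tendsto_iff_norm_sub_tendsto_zero.2 (squeeze_zero (fun _ => norm_nonneg _) ?_ hf)
    intro n
    rw [← integral_sub (integrable_unitInterval ρ _) (integrable_unitInterval ρ _)]
    simpa using norm_integral_le_of_norm_le_const (μ := ρ)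
      (.of_forall fun x => (bernsteinApproximation n f - f).norm_coe_le_norm x)
  refine ext_of_forall_integral_eq_of_IsFiniteMeasure fun f => ?_
  refine tendsto_nhds_unique (hlim μ f.toContinuousMap) ((hlim ν f.toContinuousMap).congr fun n => ?_)
  exact sum_congr rfl fun k _ => by rw [h n k k.is_le]

theorem exists_probabilityMeasure_of_cone {ω : ℕ → ℕ → ℝ}
    (hpos : ∀ K i, 0 ≤ ω K i)
    (hsum : ∀ K, ∑ i ∈ range (K + 1), ω K i = 1)
    (hcone : ∀ K i, i ≤ K →
      ω K i = (((i : ℝ) + 1) / ((K : ℝ) + 1)) * ω (K + 1) (i + 1)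
        + ((((K : ℝ) + 1) - (i : ℝ)) / ((K : ℝ) + 1)) * ω (K + 1) i) :
    ∃ μ : ProbabilityMeasure (Set.Icc (0 : ℝ) 1),
      ∀ K : ℕ, ω K K = ∫ x, (x : ℝ) ^ K ∂(μ : Measure (Set.Icc (0 : ℝ) 1)) := by
  let m (n : ℕ) : Measure (Set.Icc (0 : ℝ) 1) :=
    ∑ i : Fin (n + 1), ENNReal.ofReal (ω n i) • Measure.dirac (bernstein.z i)
  have hm (n : ℕ) : IsProbabilityMeasure (m n) := by
    refine ⟨?_⟩
    simp only [m, Measure.finsetSum_apply, Measure.smul_apply, measure_univ, smul_eq_mul, mul_one]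
    rw [Fin.sum_univ_eq_sum_range (fun i => ENNReal.ofReal (ω n i)),
      ← ENNReal.ofReal_sum_of_nonneg fun i _ => hpos n i, hsum, ENNReal.ofReal_one]
  let P (n : ℕ) : ProbabilityMeasure (Set.Icc (0 : ℝ) 1) := ⟨m n, hm n⟩
  obtain ⟨μ, -, hμ⟩ := isCompact_univ.ultrafilter_le_nhds ((hyperfilter ℕ).map P) (by simp)
  refine ⟨μ, fun K => ?_⟩
  let f : C(Set.Icc (0 : ℝ) 1, ℝ) := ⟨fun x => (x : ℝ) ^ K, by fun_prop⟩
  have hlim := ProbabilityMeasure.tendsto_iff_forall_integral_tendsto.1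
    (show Tendsto P (hyperfilter ℕ) (𝓝 μ) from hμ) (BoundedContinuousFunction.mkOfCompact f)
  refine tendsto_nhds_unique ((tendsto_sum_mul_pow_of_cone hpos hsum hcone K).mono_left
    Nat.hyperfilter_le_atTop) (hlim.congr fun n => ?_)
  change ∫ x, f x ∂(m n) = _
  rw [integral_finsetSum_measure fun i _ =>
    (integrable_unitInterval _ f).smul_measure ENNReal.ofReal_ne_top,
    ← Fin.sum_univ_eq_sum_range (fun i => ω n i * ((i : ℝ) / n) ^ K)]
  refine sum_congr rfl fun i _ => ?_
  rw [integral_smul_measure, integral_dirac, ENNReal.toReal_ofReal (hpos n i)]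
  rfl


/-- De Finetti's theorem, pointwise limit form: a cone `(ω_K)` of probability
distributions on `{0,…,K}` over the draw-and-delete chain arises from a unique Borel
probability measure `μ` on `[0,1]` by binomial mixing:
`ω_K(k) = ∫_0^1 C(K,k)·x^k·(1−x)^{K−k} dμ(x)`. -/
theorem deFinetti_pointwise
    (ω : ℕ → ℕ → ℝ)
    (hpos : ∀ K i, 0 ≤ ω K i)
    (hsupp : ∀ K i, K < i → ω K i = 0)
    (hsum : ∀ K, ∑ i ∈ Finset.range (K + 1), ω K i = 1)
    (hcone : ∀ K i, i ≤ K →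
      ω K i = (((i : ℝ) + 1) / ((K : ℝ) + 1)) * ω (K + 1) (i + 1)
        + ((((K : ℝ) + 1) - (i : ℝ)) / ((K : ℝ) + 1)) * ω (K + 1) i) :
    ∃! μ : Measure (Set.Icc (0 : ℝ) 1), IsProbabilityMeasure μ ∧
      ∀ K k : ℕ, k ≤ K →
        ω K k = ∫ x, (K.choose k : ℝ) * (x : ℝ) ^ k * (1 - (x : ℝ)) ^ (K - k) ∂μ := by
  obtain ⟨μ, hμ⟩ := exists_probabilityMeasure_of_cone hpos hsum hcone
  simp_rw [← bernstein_apply]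
  have hω : ∀ K k : ℕ, k ≤ K → ω K k = ∫ x, bernstein K k x ∂(μ : Measure _) := fun K k =>
    cone_eq_of_diagonal_eq (η := fun K k => ∫ x, bernstein K k x ∂(μ : Measure _)) hcone
      (fun K i => integral_bernstein_cone _) fun K => by simp [hμ, bernstein_apply]
  refine ⟨μ, ⟨inferInstance, hω⟩, fun ν ⟨_, hν⟩ => ?_⟩
  exact measure_eq_of_integral_bernstein_eq (ν := (μ : Measure _)) fun K k hk => by
    rw [← hν K k hk, hω K k hk]
end

section
/- The iid channel is injective (a monomorphism in the Kleisli category of the Giry monad): if μ₁ and μ₂ are Borel probability measures on [0,1] such that the corresponding mixtures of iid Bernoulli product measures on Bool^ℕ coincide — i.e. for every n ∈ ℕ and every b ∈ Bool^n, ∫_0^1 r^{#{i<n : b_i = true}} · (1−r)^{#{i<n : b_i = false}} dμ₁(r) = ∫_0^1 r^{#{i<n : b_i = true}} · (1−r)^{#{i<n : b_i = false}} dμ₂(r) — then μ₁ = μ₂. -/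
open MeasureTheory Finset

/-- The powers `r ↦ r ^ k` determine finite Borel measures on `[0,1]`. -/
theorem measure_Icc_ext_of_moments
    (μ₁ μ₂ : Measure (Set.Icc (0 : ℝ) 1)) [IsFiniteMeasure μ₁] [IsFiniteMeasure μ₂]
    (h : ∀ k : ℕ, ∫ r, (r : ℝ) ^ k ∂μ₁ = ∫ r, (r : ℝ) ^ k ∂μ₂) : μ₁ = μ₂ := by
  have continuous_int (μ : Measure (Set.Icc (0 : ℝ) 1)) [IsFiniteMeasure μ] :
      Continuous fun f : C(Set.Icc (0 : ℝ) 1, ℝ) => ∫ r, f r ∂μ := by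
    have := continuous_integral.comp (ContinuousMap.toLp (E := ℝ) 1 μ ℝ).continuous
    refine this.congr fun f => integral_congr_ae (ContinuousMap.coeFn_toLp μ f)
  have integrable (μ : Measure (Set.Icc (0 : ℝ) 1)) [IsFiniteMeasure μ]
      (f : C(Set.Icc (0 : ℝ) 1, ℝ)) : Integrable f μ :=
    (BoundedContinuousFunction.mkOfCompact f).integrable μ
  have key (f : C(Set.Icc (0 : ℝ) 1, ℝ)) : ∫ r, f r ∂μ₁ = ∫ r, f r ∂μ₂ := by
    have hf : f ∈ (polynomialFunctions (Set.Icc (0 : ℝ) 1)).topologicalClosure := by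
      rw [polynomialFunctions_closure_eq_top]; trivial
    refine closure_minimal (t := {f | ∫ r, f r ∂μ₁ = ∫ r, f r ∂μ₂}) ?_
      (isClosed_eq (continuous_int μ₁) (continuous_int μ₂)) hf
    rintro _ ⟨p, -, rfl⟩
    have eval (μ : Measure (Set.Icc (0 : ℝ) 1)) [IsFiniteMeasure μ] :
        ∫ r, p.eval (r : ℝ) ∂μ = ∑ i ∈ range (p.natDegree + 1), p.coeff i * ∫ r, (r : ℝ) ^ i ∂μ := by
      simp_rw [Polynomial.eval_eq_sum_range]
      rw [integral_finsetSum]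
      · simp_rw [integral_const_mul]
      · intro i _
        exact integrable μ ⟨fun r => p.coeff i * (r : ℝ) ^ i, by fun_prop⟩
    change ∫ r, p.eval (r : ℝ) ∂μ₁ = ∫ r, p.eval (r : ℝ) ∂μ₂
    simp_rw [eval, h]
  exact ext_of_forall_integral_eq_of_IsFiniteMeasure fun f => key f.toContinuousMap

/-- The iid channel `[0,1] ⤳ Bool^ℕ` is a monomorphism in the Kleisli category of the
Giry monad: if two Borel probability measures on `[0,1]` induce the same mixture of
iid Bernoulli product measures — i.e. they agree on all cylinder probabilities
`∫_0^1 r^{#true}·(1−r)^{#false} dμ(r)` — then they are equal. -/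
theorem iid_mono
    (μ₁ μ₂ : Measure (Set.Icc (0 : ℝ) 1))
    [IsProbabilityMeasure μ₁] [IsProbabilityMeasure μ₂]
    (h : ∀ (n : ℕ) (b : Fin n → Bool),
      (∫ r, (r : ℝ) ^ (Finset.univ.filter fun i => b i = true).card
          * (1 - (r : ℝ)) ^ (Finset.univ.filter fun i => b i = false).card ∂μ₁)
        = ∫ r, (r : ℝ) ^ (Finset.univ.filter fun i => b i = true).card
            * (1 - (r : ℝ)) ^ (Finset.univ.filter fun i => b i = false).card ∂μ₂) :
    μ₁ = μ₂ := by
  refine measure_Icc_ext_of_moments μ₁ μ₂ fun k => ?_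
  simpa using h k fun _ => true
end
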